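/- Let ψ : A → ℂ be a positive right integral. Fix a, a' ∈ A and define the linear functional ω : A → ℂ by ω(y) = ψ(star a' * y * a), and the linear map L : A → A by L x = (id ⊗ ω)(Δ x). Then there exists a constant C ≥ 0 such that for all x ∈ A, (ψ(star (L x) * (L x))).re ≤ C * (ψ(star x * x)).re. -/

import Mathlib

open scoped TensorProduct
open TensorProduct
open scoped ComplexOrder

/-- The factorwise star on `A ⊗[ℂ] A`, as an additive map. -/
noncomputable def tensorStar (A : Type*) [Ring A] [Algebra ℂ A] [StarRing A] [StarModule ℂ A] :
    A ⊗[ℂ] A →+ A ⊗[ℂ] A :=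
  TensorProduct.liftAddHom
    (AddMonoidHom.mk' (fun x => AddMonoidHom.mk' (fun y => star x ⊗ₜ[ℂ] star y)
        (fun y z => by simp [star_add, TensorProduct.tmul_add]))
      (fun x y => by ext z; simp [star_add, TensorProduct.add_tmul]))
    (fun c m n => by
      simp only [AddMonoidHom.mk'_apply, star_smul, TensorProduct.smul_tmul,
        TensorProduct.tmul_smul, starRingEnd_apply])

/-- `(φ ⊗ id)` as a map `A ⊗[ℂ] A →ₗ[ℂ] A`. -/
noncomputable def lApply (A : Type*) [Ring A] [Algebra ℂ A] (φ : A →ₗ[ℂ] ℂ) :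
    A ⊗[ℂ] A →ₗ[ℂ] A :=
  (TensorProduct.lid ℂ A).toLinearMap ∘ₗ TensorProduct.map φ LinearMap.id

/-- A linear functional is a right integral: `(ψ ⊗ id)(Δ a) = ψ(a) • 1`. -/
def IsRightIntegral (A : Type*) [Ring A] [Bialgebra ℂ A] (ψ : A →ₗ[ℂ] ℂ) : Prop :=
  ∀ a : A, lApply A ψ (Coalgebra.comul (R := ℂ) a) = ψ a • (1 : A)


/-- `(id ⊗ φ)` as a map `A ⊗[ℂ] A →ₗ[ℂ] A`. -/
noncomputable def rApply (A : Type*) [Ring A] [Algebra ℂ A] (φ : A →ₗ[ℂ] ℂ) :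
    A ⊗[ℂ] A →ₗ[ℂ] A :=
  (TensorProduct.rid ℂ A).toLinearMap ∘ₗ TensorProduct.map LinearMap.id φ

section PositiveFunctional

variable {A : Type*} [Ring A] [Algebra ℂ A] [StarRing A] [StarModule ℂ A] {ψ : A →ₗ[ℂ] ℂ}

/-- A positive functional on a unital *-algebra is Hermitian. -/
theorem map_star_of_star_mul_self_nonneg (hpos : ∀ a : A, 0 ≤ ψ (star a * a)) (x : A) :
    ψ (star x) = star (ψ x) := by
  have h0 := (Complex.nonneg_iff.1 (hpos 1)).2
  have hx := (Complex.nonneg_iff.1 (hpos x)).2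
  have h1 := (Complex.nonneg_iff.1 (hpos (1 + x))).2
  have h2 := (Complex.nonneg_iff.1 (hpos (1 + Complex.I • x))).2
  simp [add_mul, mul_add] at h0 hx h1 h2
  apply Complex.ext <;> simp <;> linarith

/-- The positive semidefinite inner product `⟪x, y⟫ = ψ (star x * y)` of a positive functional. -/
@[reducible]
noncomputable def gnsCore (hpos : ∀ a : A, 0 ≤ ψ (star a * a)) :
    PreInnerProductSpace.Core ℂ A where
  inner x y := ψ (star x * y)
  conj_inner_symm x y := by
    rw [starRingEnd_apply, ← map_star_of_star_mul_self_nonneg hpos, star_mul, star_star]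
  re_inner_nonneg x := (Complex.nonneg_iff.1 (hpos x)).1
  add_left x y z := by simp [add_mul]
  smul_left x y r := by simp

/-- The **Cauchy-Schwarz inequality** for a positive functional. -/
theorem star_mul_map_le_of_star_mul_self_nonneg (hpos : ∀ a : A, 0 ≤ ψ (star a * a)) (x y : A) :
    star (ψ (star x * y)) * ψ (star x * y) ≤ ψ (star x * x) * ψ (star y * y) := by
  have h : ‖ψ (star x * y)‖ * ‖ψ (star y * x)‖ ≤ (ψ (star x * x)).re * (ψ (star y * y)).re :=
    @InnerProductSpace.Core.inner_mul_inner_self_le ℂ A _ _ _ (gnsCore hpos) x y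
  have hyx : ψ (star y * x) = star (ψ (star x * y)) := by
    rw [← map_star_of_star_mul_self_nonneg hpos, star_mul, star_star]
  rw [hyx, norm_star] at h
  rw [Complex.eq_re_of_ofReal_le (hpos x), Complex.eq_re_of_ofReal_le (hpos y),
    Complex.star_def, Complex.conj_mul', sq]
  exact_mod_cast h

variable {ι : Type*} [Fintype ι]

theorem posSemidef_gram_of_star_mul_self_nonneg (hpos : ∀ a : A, 0 ≤ ψ (star a * a))
    (p : ι → A) : (Matrix.of fun i j => ψ (star (p i) * p j)).PosSemidef := by
  refine .of_dotProduct_mulVec_nonneg ?_ fun v => ?_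
  · ext i j
    simp [← map_star_of_star_mul_self_nonneg hpos]
  · convert hpos (∑ j, v j • p j) using 1
    simp [dotProduct, Matrix.mulVec, Finset.mul_sum, Finset.sum_mul, star_sum]
    rw [Finset.sum_comm]
    exact Finset.sum_congr rfl fun _ _ => Finset.sum_congr rfl fun _ _ => by ring

theorem posSemidef_cauchySchwarz_of_star_mul_self_nonneg (hpos : ∀ a : A, 0 ≤ ψ (star a * a))
    (b : A) (q : ι → A) :
    (Matrix.of fun i j => ψ (star b * b) * ψ (star (q i) * q j) -
      star (ψ (star b * q i)) * ψ (star b * q j)).PosSemidef := by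
  refine .of_dotProduct_mulVec_nonneg ?_ fun v => ?_
  · ext i j
    simp [← map_star_of_star_mul_self_nonneg hpos, mul_comm]
  · convert sub_nonneg.2 (star_mul_map_le_of_star_mul_self_nonneg hpos b (∑ j, v j • q j)) using 1
    simp [dotProduct, Matrix.mulVec, Finset.mul_sum, Finset.sum_mul, star_sum]
    rw [Finset.sum_comm]
    simp only [← Finset.sum_sub_distrib]
    exact Finset.sum_congr rfl fun _ _ => Finset.sum_congr rfl fun _ _ => by ring

/-- The slice map `id ⊗ ψ (star b * ·)` is bounded for the inner product of `ψ ⊗ ψ`. -/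
theorem map_star_slice_mul_slice_le (hpos : ∀ a : A, 0 ≤ ψ (star a * a))
    (b : A) (p q : ι → A) :
    ψ (star (∑ i, ψ (star b * q i) • p i) * ∑ i, ψ (star b * q i) • p i) ≤
      ψ (star b * b) * ∑ i, ∑ j, ψ (star (p i) * p j) * ψ (star (q i) * q j) := by
  have h := ((posSemidef_gram_of_star_mul_self_nonneg hpos p).hadamard
    (posSemidef_cauchySchwarz_of_star_mul_self_nonneg hpos b q)).dotProduct_mulVec_nonneg 1
  rw [← sub_nonneg]
  convert h using 1
  simp [dotProduct, Matrix.mulVec, Finset.mul_sum, Finset.sum_mul, star_sum, mul_sub]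
  congr 1
  · exact Finset.sum_congr rfl fun _ _ => Finset.sum_congr rfl fun _ _ => by ring
  · rw [Finset.sum_comm]
    exact Finset.sum_congr rfl fun _ _ => Finset.sum_congr rfl fun _ _ => by ring

end PositiveFunctional

theorem stmt10 (A : Type*) [Ring A] [HopfAlgebra ℂ A] [StarRing A] [StarModule ℂ A]
    (hΔstar : ∀ a : A, Coalgebra.comul (R := ℂ) (star a) =
      tensorStar A (Coalgebra.comul (R := ℂ) a))
    (ψ : A →ₗ[ℂ] ℂ) (hψ : IsRightIntegral A ψ)
    (hpos : ∀ a : A, 0 ≤ ψ (star a * a))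
    (a a' : A)
    (ω : A →ₗ[ℂ] ℂ) (hω : ∀ y : A, ω y = ψ (star a' * y * a))
    (L : A →ₗ[ℂ] A) (hL : ∀ x : A, L x = rApply A ω (Coalgebra.comul (R := ℂ) x)) :
    ∃ C : ℝ, 0 ≤ C ∧
      ∀ x : A, (ψ (star (L x) * (L x))).re ≤ C * (ψ (star x * x)).re := by
  refine ⟨(ψ (star a' * a')).re * (ψ (star a * a)).re,
    mul_nonneg (Complex.nonneg_iff.1 (hpos a')).1 (Complex.nonneg_iff.1 (hpos a)).1, fun x => ?_⟩
  obtain ⟨S, hS⟩ := TensorProduct.exists_finset (Coalgebra.comul (R := ℂ) x)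
  rw [← Finset.sum_coe_sort] at hS
  have hLx : L x = ∑ i : S, ψ (star a' * (i.1.2 * a)) • i.1.1 := by
    simp [hL, hS, rApply, hω, mul_assoc]
  have hψx : ψ (star x * x) • (1 : A) =
      ∑ i : S, ∑ j : S, ψ (star i.1.1 * j.1.1) • (star i.1.2 * j.1.2) := by
    rw [← hψ, Bialgebra.comul_mul, hΔstar, hS]
    simp [lApply, tensorStar, Finset.sum_mul_sum]
  have hisom : ∑ i : S, ∑ j : S, ψ (star i.1.1 * j.1.1) * ψ (star (i.1.2 * a) * (j.1.2 * a)) =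
      ψ (star x * x) * ψ (star a * a) := by
    have h := congrArg (fun y => ψ (star a * y * a)) hψx
    simp [Finset.mul_sum, Finset.sum_mul] at h
    simp [h, mul_assoc]
  have h := map_star_slice_mul_slice_le hpos a' (fun i : S => i.1.1) (fun i => i.1.2 * a)
  rw [← hLx, hisom] at h
  have hre := (Complex.le_def.1 h).1
  have e1 := (Complex.nonneg_iff.1 (hpos a)).2
  have e2 := (Complex.nonneg_iff.1 (hpos a')).2
  simp only [Complex.mul_re, Complex.mul_im, ← e1, ← e2] at hre
  linarith
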